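/- arXiv:0801.0401 — 4 statements merged into one kernel-verified Lean document; each statement's English description precedes it below -/
import Mathlib

section
/- Let k be a commutative artinian ring and let Λ be a k-algebra that is finitely generated as a k-module (an Artin algebra). Then Λ satisfies the uniform Auslander condition (UAC) if and only if the opposite algebra Λᵒᵖ satisfies (UAC). -/
open CategoryTheory

universe u

noncomputable abbrev ExtGroup {A : Type u} [Ring A] (M N : ModuleCat.{u} A) (i : ℕ) :=
  ((Ext ℤ (ModuleCat.{u} A) i).obj (Opposite.op M)).obj N

/-- The uniform Auslander condition (UAC). -/
def SatisfiesUAC (A : Type u) [Ring A] : Prop :=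
  ∃ b : ℕ, ∀ M N : ModuleCat.{u} A, Module.Finite A M → Module.Finite A N →
    (∃ n : ℕ, ∀ i ≥ n, Subsingleton (ExtGroup M N i)) →
    ∀ i > b, Subsingleton (ExtGroup M N i)

section Category
open Abelian Abelian.Ext

variable {C : Type*} [Category* C] [Abelian C] [HasExt.{u} C]

theorem subsingleton_ext_one_iff_of_projective {S : ShortComplex C} (hS : S.ShortExact)
    [Projective S.X₂] (Y : C) :
    Subsingleton (Abelian.Ext.{u} S.X₃ Y 1) ↔ ∀ f : S.X₁ ⟶ Y, ∃ g : S.X₂ ⟶ Y, S.f ≫ g = f := by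
  constructor
  · intro h f
    obtain ⟨x, hx⟩ := contravariant_sequence_exact₁ hS Y (mk₀ f) (n₁ := 1) rfl
      (Subsingleton.elim _ _)
    obtain ⟨g, rfl⟩ := (mk₀_bijective _ _).2 x
    refine ⟨g, (mk₀_bijective _ _).1 ?_⟩
    simpa using hx
  · intro h
    refine subsingleton_of_forall_eq 0 fun e => ?_
    obtain ⟨x, rfl⟩ := contravariant_sequence_exact₃ hS Y e (eq_zero_of_projective _)
      (n₀ := 0) rfl
    obtain ⟨f, rfl⟩ := (mk₀_bijective _ _).2 x
    obtain ⟨g, rfl⟩ := h f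
    rw [← mk₀_comp_mk₀, ← Abelian.Ext.comp_assoc (α := hS.extClass) _ _ (by rfl) (by rfl) (by rfl)]
    simp

theorem subsingleton_ext_one_iff_of_injective {S : ShortComplex C} (hS : S.ShortExact)
    [Injective S.X₂] (Y : C) :
    Subsingleton (Abelian.Ext.{u} Y S.X₁ 1) ↔ ∀ f : Y ⟶ S.X₃, ∃ g : Y ⟶ S.X₂, g ≫ S.g = f := by
  constructor
  · intro h f
    obtain ⟨x, hx⟩ := covariant_sequence_exact₃ Y hS (mk₀ f) (n₁ := 1) rfl
      (Subsingleton.elim _ _)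
    obtain ⟨g, rfl⟩ := (mk₀_bijective _ _).2 x
    refine ⟨g, (mk₀_bijective _ _).1 ?_⟩
    simpa using hx
  · intro h
    refine subsingleton_of_forall_eq 0 fun e => ?_
    obtain ⟨x, rfl⟩ := covariant_sequence_exact₁ Y hS e (eq_zero_of_injective _)
      (n₀ := 0) rfl
    obtain ⟨f, rfl⟩ := (mk₀_bijective _ _).2 x
    obtain ⟨g, rfl⟩ := h f
    rw [← mk₀_comp_mk₀, Abelian.Ext.comp_assoc _ _ _ (by rfl) (by rfl) (by rfl)]
    simp

theorem subsingleton_ext_succ_iff_of_projective {S : ShortComplex C} (hS : S.ShortExact)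
    [Projective S.X₂] (Y : C) (n : ℕ) :
    Subsingleton (Abelian.Ext.{u} S.X₃ Y (n + 2)) ↔
      Subsingleton (Abelian.Ext.{u} S.X₁ Y (n + 1)) := by
  constructor
  · refine fun h => subsingleton_of_forall_eq 0 fun e => ?_
    obtain ⟨x, rfl⟩ := contravariant_sequence_exact₁ hS Y e (n₁ := n + 2) (by lia)
      (Subsingleton.elim _ _)
    rw [eq_zero_of_projective x, comp_zero]
  · refine fun h => subsingleton_of_forall_eq 0 fun e => ?_
    obtain ⟨x, rfl⟩ := contravariant_sequence_exact₃ hS Y e (eq_zero_of_projective _)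
      (n₀ := n + 1) (by lia)
    rw [Subsingleton.elim x 0, comp_zero]

theorem subsingleton_ext_succ_iff_of_injective {S : ShortComplex C} (hS : S.ShortExact)
    [Injective S.X₂] (Y : C) (n : ℕ) :
    Subsingleton (Abelian.Ext.{u} Y S.X₁ (n + 2)) ↔
      Subsingleton (Abelian.Ext.{u} Y S.X₃ (n + 1)) := by
  constructor
  · refine fun h => subsingleton_of_forall_eq 0 fun e => ?_
    obtain ⟨x, rfl⟩ := covariant_sequence_exact₃ Y hS e (n₁ := n + 2) (by lia)
      (Subsingleton.elim _ _)
    rw [eq_zero_of_injective x, zero_comp]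
  · refine fun h => subsingleton_of_forall_eq 0 fun e => ?_
    obtain ⟨x, rfl⟩ := covariant_sequence_exact₁ Y hS e (eq_zero_of_injective _)
      (n₀ := n + 1) (by lia)
    rw [Subsingleton.elim x 0, zero_comp]

end Category

theorem subsingleton_extGroup_succ_iff {A : Type u} [Ring A] (M N : ModuleCat.{u} A) (n : ℕ) :
    Subsingleton (ExtGroup M N (n + 1)) ↔ Subsingleton (Abelian.Ext.{u} M N (n + 1)) := by
  let P := projectiveResolution M
  have h₁ : Subsingleton (Abelian.Ext.{u} M N (n + 1)) ↔
      ∀ f : P.complex.X (n + 1) ⟶ N, P.complex.d (n + 2) (n + 1) ≫ f = 0 →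
        ∃ g : P.complex.X n ⟶ N, P.complex.d (n + 1) n ≫ g = f := by
    constructor
    · intro h f hf
      exact (P.extMk_eq_zero_iff f (n + 2) rfl hf n rfl).1 (Subsingleton.elim _ _)
    · refine fun h => subsingleton_of_forall_eq 0 fun e => ?_
      obtain ⟨f, hf, rfl⟩ := P.extMk_surjective e (n + 2) rfl
      exact (P.extMk_eq_zero_iff f (n + 2) rfl hf n rfl).2 (h f hf)
  rw [h₁, ((forget (ModuleCat ℤ)).mapIso (P.isoExt (R := ℤ) (n + 1) N)).toEquiv.subsingleton_congr]
  change Subsingleton ((P.complex.linearYonedaObj ℤ N).homology (n + 1)) ↔ _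
  rw [← ModuleCat.isZero_iff_subsingleton, ← HomologicalComplex.exactAt_iff_isZero_homology,
    HomologicalComplex.exactAt_iff' _ n (n + 1) (n + 2) (by simp) (by simp),
    ShortComplex.moduleCat_exact_iff]
  rfl

section InjectiveCogenerator

theorem Submodule.exists_maximal_disjoint {R M : Type*} [Ring R] [AddCommGroup M] [Module R M]
    {W V : Submodule R M} (h : Disjoint W V) :
    ∃ C : Submodule R M, V ≤ C ∧ Disjoint W C ∧ ∀ D, C ≤ D → Disjoint W D → D ≤ C := by
  obtain ⟨C, hVC, hC⟩ := zorn_le_nonempty₀ {C : Submodule R M | Disjoint W C}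
    (fun c hc hchain y hy => ⟨sSup c, hchain.directedOn.disjoint_sSup_right.2 fun a ha => hc ha,
      fun z hz => le_sSup hz⟩) V h
  exact ⟨C, hVC, hC.prop, fun D hD hWD => hC.le_of_ge hWD hD⟩

theorem Module.exists_injective_essential_extension {R : Type u} [Ring R]
    (W : Type u) [AddCommGroup W] [Module R W] :
    ∃ (E : Type u) (_ : AddCommGroup E) (_ : Module R E) (ι : W →ₗ[R] E),
      Module.Injective R E ∧ Function.Injective ι ∧
        ∀ S : Submodule R E, Disjoint (LinearMap.range ι) S → S = ⊥ := by
  obtain ⟨⟨I, hI, i, hi⟩⟩ := EnoughInjectives.presentation (ModuleCat.of R W)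
  have hI : Module.Injective R I := (Module.injective_iff_injective_object R I).2 hI
  have hi : Function.Injective i.hom := (ModuleCat.mono_iff_injective i).1 hi
  let W' : Submodule R I := LinearMap.range i.hom
  obtain ⟨C, -, hWC, hC⟩ := Submodule.exists_maximal_disjoint (disjoint_bot_right (a := W'))
  obtain ⟨E, hWE, hCE, hE⟩ := Submodule.exists_maximal_disjoint hWC.symm
  obtain ⟨g, hg⟩ := Module.Injective.extension_property R I _ _ (C.mkQ ∘ₗ E.subtype)
    (by
      rw [← LinearMap.ker_eq_bot, LinearMap.ker_comp, Submodule.ker_mkQ,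
        ← Submodule.disjoint_iff_comap_eq_bot]
      exact hCE.symm) E.subtype
  let p : I →ₗ[R] I := g ∘ₗ C.mkQ
  have hpE (x : I) (hx : x ∈ E) : p x = x := LinearMap.congr_fun hg ⟨x, hx⟩
  have hpC (x : I) (hx : x ∈ C) : p x = 0 := by
    simp [p, (Submodule.Quotient.mk_eq_zero C).2 hx]
  have hpc (x : I) (hx : p x ∈ C) : x ∈ C := by
    refine hC (C.comap p) (fun y hy => ?_) ?_ hx
    · simp [hpC y hy]
    · rw [Submodule.disjoint_def]
      intro w hw hw'
      rw [Submodule.mem_comap, hpE w (hWE hw)] at hw'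
      exact Submodule.disjoint_def.1 hWC w hw hw'
  have hpr : LinearMap.range p ≤ E := by
    refine hE _ (fun x hx => ⟨x, hpE x hx⟩) ?_
    rw [Submodule.disjoint_def]
    rintro _ hx ⟨x, rfl⟩
    exact hpC x (hpc x hx)
  refine ⟨E, inferInstance, inferInstance, i.hom.codRestrict E fun w => hWE ⟨w, rfl⟩, ⟨?_⟩, ?_, ?_⟩
  · intro X Y _ _ _ _ f hf q
    obtain ⟨h, hh⟩ := Module.Injective.extension_property R I _ _ f hf (E.subtype ∘ₗ q)
    refine ⟨(p.codRestrict E fun x => hpr ⟨x, rfl⟩) ∘ₗ h, fun x => Subtype.ext ?_⟩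
    have : h (f x) = q x := LinearMap.congr_fun hh x
    simp [this, hpE]
  · intro x y hxy
    exact hi (congrArg Subtype.val hxy)
  · intro S hS
    rw [eq_bot_iff]
    intro s hs
    have hle : S.map E.subtype ⊔ C ≤ C := by
      refine hC _ le_sup_right ?_
      rw [Submodule.disjoint_def]
      intro w hw hw'
      obtain ⟨_, ⟨t, ht, rfl⟩, c, hc, rfl⟩ := Submodule.mem_sup.1 hw'
      have hcE : c ∈ E := by simpa using E.sub_mem (hWE hw) t.2
      obtain rfl := Submodule.disjoint_def.1 hCE c hc hcE
      obtain ⟨v, hv⟩ := hw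
      have : t = 0 := Submodule.disjoint_def.1 hS t ⟨v, Subtype.ext (by simpa using hv)⟩ ht
      simp [this]
    exact Subtype.ext (Submodule.disjoint_def.1 hCE _
      (hle (Submodule.mem_sup_left ⟨s, hs, rfl⟩)) s.2)

variable (k : Type u) [CommRing k]

/-- An injective module `E` such that `Hom(-, E)` is faithful and has length at most one on simple
modules. -/
structure IsMinimalInjectiveCogenerator (E : Type u) [AddCommGroup E] [Module k E] : Prop where
  injective : Module.Injective k E
  exists_apply_ne_zero {M : Type u} [AddCommGroup M] [Module k M] (x : M) (hx : x ≠ 0) :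
    ∃ f : M →ₗ[k] E, f x ≠ 0
  length_le_one {S : Type u} [AddCommGroup S] [Module k S] [IsSimpleModule k S] :
    Module.length k (S →ₗ[k] E) ≤ 1

theorem exists_isMinimalInjectiveCogenerator :
    ∃ (E : Type u) (_ : AddCommGroup E) (_ : Module k E), IsMinimalInjectiveCogenerator k E := by
  classical
  obtain ⟨E, _, _, ι, hE, hι, hess⟩ := Module.exists_injective_essential_extension (R := k)
    (∀ m : MaximalSpectrum k, k ⧸ m.asIdeal)
  refine ⟨E, inferInstance, inferInstance, hE, ?_, ?_⟩
  · intro M _ _ x hx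
    let t := LinearMap.toSpanSingleton k M x
    have ht : LinearMap.ker t ≠ ⊤ := by
      rw [Ne, Ideal.eq_top_iff_one]
      simpa [t] using hx
    obtain ⟨m, hm, hle⟩ := Ideal.exists_le_maximal _ ht
    let j : k →ₗ[k] E := ι ∘ₗ LinearMap.single k (fun m : MaximalSpectrum k => k ⧸ m.asIdeal)
      ⟨m, hm⟩ ∘ₗ Submodule.mkQ m
    obtain ⟨h, hh⟩ := Module.Injective.extension_property k E _ _ ((LinearMap.ker t).liftQ t le_rfl)
      (by rw [← LinearMap.ker_eq_bot]; exact Submodule.ker_liftQ_eq_bot _ _ _ le_rfl)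
      ((LinearMap.ker t).liftQ j (fun a ha => by
        simp [j, Ideal.Quotient.eq_zero_iff_mem.2 (hle ha)]))
    refine ⟨h, ?_⟩
    have h1 : h x = j 1 := by
      have := LinearMap.congr_fun hh (Submodule.Quotient.mk 1)
      rw [LinearMap.comp_apply, Submodule.liftQ_apply, Submodule.liftQ_apply] at this
      simpa [t] using this
    rw [h1]
    simp only [j, LinearMap.comp_apply]
    rw [Ne, map_eq_zero_iff ι hι, LinearMap.single_apply, Pi.single_eq_zero_iff]
    simp
  · intro S _ _ hS
    obtain ⟨m, hm, ⟨e⟩⟩ := isSimpleModule_iff_quot_maximal.1 hS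
    cases subsingleton_or_nontrivial (S →ₗ[k] E) with
    | inl h => simp [Module.length_eq_zero]
    | inr h =>
      suffices IsSimpleModule k (S →ₗ[k] E) from (Module.length_eq_one k _).le
      let s : S := e.symm (Submodule.Quotient.mk 1)
      have hs (x : S) : ∃ a : k, a • s = x := by
        obtain ⟨a, ha⟩ := Submodule.Quotient.mk_surjective _ (e x)
        exact ⟨a, by rw [← map_smul, ← Submodule.Quotient.mk_smul, smul_eq_mul, mul_one, ha,
          e.symm_apply_apply]⟩
      have hms (a : k) (ha : a ∈ m) : a • s = 0 := by
        rw [← map_smul, ← Submodule.Quotient.mk_smul, smul_eq_mul, mul_one,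
          (Submodule.Quotient.mk_eq_zero m).2 ha, map_zero]
      have hφ (φ : S →ₗ[k] E) : ∃ x : k ⧸ m, φ s = ι (Pi.single
          (M := fun m : MaximalSpectrum k => k ⧸ m.asIdeal) ⟨m, hm⟩ x) := by
        have : φ s ∈ LinearMap.range ι := by
          by_contra hn
          have h0 : LinearMap.range φ = ⊥ := by
            refine hess _ (Submodule.disjoint_def.2 ?_)
            rintro _ hy ⟨y, rfl⟩
            rcases eq_bot_or_eq_top ((LinearMap.range ι).comap φ) with hb | ht
            · have : y = 0 := (Submodule.mem_bot k).1 (hb ▸ hy)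
              simp [this]
            · exact absurd (ht ▸ Submodule.mem_top : s ∈ (LinearMap.range ι).comap φ) hn
          rw [LinearMap.range_eq_bot] at h0
          exact hn (by simp [h0])
        obtain ⟨w, hw⟩ := this
        refine ⟨w ⟨m, hm⟩, ?_⟩
        rw [← hw]
        congr 1
        ext n
        by_cases hn : n = ⟨m, hm⟩
        · subst hn; simp
        · rw [Pi.single_eq_of_ne hn]
          obtain ⟨a, ha, han⟩ := Set.not_subset.1 fun hle : (m : Set k) ⊆ n.asIdeal =>
            hn (MaximalSpectrum.ext (hm.eq_of_le n.isMaximal.ne_top hle).symm)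
          have haw : a • w = 0 := hι (by rw [map_smul, hw, ← map_smul, hms a ha]; simp)
          have hawn : a • w n = 0 := congrFun haw n
          obtain ⟨b, hb⟩ := Submodule.Quotient.mk_surjective _ (w n)
          rw [← hb, ← Submodule.Quotient.mk_smul, Submodule.Quotient.mk_eq_zero] at hawn
          rw [← hb, Submodule.Quotient.mk_eq_zero]
          exact (n.isMaximal.isPrime.mem_or_mem hawn).resolve_left han
      rw [isSimpleModule_iff_toSpanSingleton_surjective]
      refine ⟨h, fun φ hφ0 ψ => ?_⟩
      obtain ⟨x, hx⟩ := hφ φ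
      obtain ⟨y, hy⟩ := hφ ψ
      have hx0 : x ≠ 0 := by
        rintro rfl
        refine hφ0 (LinearMap.ext fun z => ?_)
        obtain ⟨a, rfl⟩ := hs z
        simp [hx]
      have : IsSimpleModule k (k ⧸ m) := isSimpleModule_iff_isCoatom.2 hm.out
      obtain ⟨a, ha⟩ := (isSimpleModule_iff_toSpanSingleton_surjective.1 this).2 x hx0 y
      refine ⟨a, LinearMap.ext fun z => ?_⟩
      obtain ⟨b, rfl⟩ := hs z
      rw [LinearMap.toSpanSingleton_apply] at ha ⊢
      rw [map_smul, map_smul, LinearMap.smul_apply, hx, hy, ← ha, ← map_smul, Pi.single_smul]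

namespace IsMinimalInjectiveCogenerator

variable {k} {E : Type u} [AddCommGroup E] [Module k E] (hE : IsMinimalInjectiveCogenerator k E)

include hE

theorem length_hom_le {M : Type u} [AddCommGroup M] [Module k M] (hM : IsFiniteLength k M) :
    Module.length k (M →ₗ[k] E) ≤ Module.length k M := by
  induction hM with
  | of_subsingleton => simp [Module.length_eq_zero]
  | @of_simple_quotient M _ _ N _ _ ih =>
    have := hE.injective
    rw [Module.length_eq_add_of_exact (N.mkQ.lcomp k E) (N.subtype.lcomp k E)
      (fun f g h => by ext x; exact LinearMap.congr_fun h x)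
      (fun f => Module.Injective.extension_property k E _ _ _ N.subtype_injective f)
      (fun f => ⟨fun h => ⟨N.liftQ f fun x hx => LinearMap.congr_fun h ⟨x, hx⟩, by ext; rfl⟩,
        by rintro ⟨g, rfl⟩; ext x; simp [(Submodule.Quotient.mk_eq_zero N).2 x.2]⟩),
      Module.length_eq_add_of_exact N.subtype N.mkQ N.subtype_injective N.mkQ_surjective
        (LinearMap.exact_subtype_mkQ N), Module.length_eq_one k (M ⧸ N), add_comm]
    exact add_le_add ih hE.length_le_one

theorem isFiniteLength_hom {M : Type u} [AddCommGroup M] [Module k M] (hM : IsFiniteLength k M) :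
    IsFiniteLength k (M →ₗ[k] E) :=
  Module.length_ne_top_iff.1
    ((hE.length_hom_le hM).trans_lt (Module.length_ne_top_iff.2 hM).lt_top).ne

theorem bijective_applyₗ {M : Type u} [AddCommGroup M] [Module k M] (hM : IsFiniteLength k M) :
    Function.Bijective (LinearMap.applyₗ : M →ₗ[k] (M →ₗ[k] E) →ₗ[k] E) := by
  have hinj : Function.Injective (LinearMap.applyₗ : M →ₗ[k] (M →ₗ[k] E) →ₗ[k] E) := by
    rw [injective_iff_map_eq_zero]
    intro x hx
    by_contra h
    obtain ⟨f, hf⟩ := hE.exists_apply_ne_zero x h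
    exact hf (LinearMap.congr_fun hx f)
  refine ⟨hinj, ?_⟩
  have hD := hE.isFiniteLength_hom hM
  obtain ⟨_, _⟩ := isFiniteLength_iff_isNoetherian_isArtinian.1 (hE.isFiniteLength_hom hD)
  rw [← LinearMap.range_eq_top]
  by_contra h
  refine absurd (Submodule.length_lt h) (not_lt.2 ?_)
  rw [← (LinearEquiv.ofInjective _ hinj).length_eq]
  exact (hE.length_hom_le hD).trans (hE.length_hom_le hM)

end IsMinimalInjectiveCogenerator

end InjectiveCogenerator

section MatlisDual

open MulOpposite

variable {k A B : Type u} [CommRing k] [Ring A] [Algebra k A] [Ring B] [Algebra k B]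

/-- The module `Hom_k(M, E)` over `B ≃ Aᵐᵒᵖ`, for an `A`-module `M`. -/
def MatlisDual (_ : B ≃ₐ[k] Aᵐᵒᵖ) (E M : Type u) [AddCommGroup E] [Module k E]
    [AddCommGroup M] [Module k M] : Type u :=
  M →ₗ[k] E

namespace MatlisDual

variable {e : B ≃ₐ[k] Aᵐᵒᵖ} {e' : A ≃ₐ[k] Bᵐᵒᵖ} {E : Type u} [AddCommGroup E] [Module k E]
  {M : Type u} [AddCommGroup M] [Module k M]

instance : AddCommGroup (MatlisDual e E M) := inferInstanceAs (AddCommGroup (M →ₗ[k] E))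

instance : Module k (MatlisDual e E M) := inferInstanceAs (Module k (M →ₗ[k] E))

instance : FunLike (MatlisDual e E M) M E := inferInstanceAs (FunLike (M →ₗ[k] E) M E)

instance : LinearMapClass (MatlisDual e E M) k M E :=
  inferInstanceAs (LinearMapClass (M →ₗ[k] E) k M E)

@[ext]
theorem ext {f g : MatlisDual e E M} (h : ∀ x, f x = g x) : f = g :=
  LinearMap.ext h

@[simp]
theorem add_apply (f g : MatlisDual e E M) (x : M) : (f + g) x = f x + g x := rfl

@[simp]
theorem zero_apply (x : M) : (0 : MatlisDual e E M) x = 0 := rfl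

@[simp]
theorem smul_apply (c : k) (f : MatlisDual e E M) (x : M) : (c • f) x = c • f x := rfl

variable [Module A M] [IsScalarTower k A M]
  {N : Type u} [AddCommGroup N] [Module k N] [Module A N] [IsScalarTower k A N]
  {X : Type u} [AddCommGroup X] [Module k X] [Module B X] [IsScalarTower k B X]

instance : SMul B (MatlisDual e E M) where
  smul b f := LinearMap.comp (f : M →ₗ[k] E) (Algebra.lsmul k k M (unop (e b)))

@[simp]
theorem algebra_smul_apply (b : B) (f : MatlisDual e E M) (x : M) :
    (b • f) x = f (unop (e b) • x) := rfl

instance : Module B (MatlisDual e E M) where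
  one_smul f := by ext; simp
  mul_smul a b f := by ext; simp [mul_smul]
  smul_zero a := by ext; simp
  smul_add a f g := by ext; simp
  add_smul a b f := by ext; simp [add_smul]
  zero_smul f := by ext; simp

instance : IsScalarTower k B (MatlisDual e E M) where
  smul_assoc c b f := by ext; simp

/-- The contravariant functoriality of `MatlisDual`. -/
def map (e : B ≃ₐ[k] Aᵐᵒᵖ) (E : Type u) [AddCommGroup E] [Module k E] (f : M →ₗ[A] N) :
    MatlisDual e E N →ₗ[B] MatlisDual e E M where
  toFun g := LinearMap.comp (g : N →ₗ[k] E) (f.restrictScalars k)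
  map_add' _ _ := rfl
  map_smul' b g := by
    refine LinearMap.ext fun x => ?_
    exact congrArg g (f.map_smul _ x).symm

@[simp]
theorem map_apply (f : M →ₗ[A] N) (g : MatlisDual e E N) (x : M) : map e E f g x = g (f x) := rfl

theorem map_injective {f : M →ₗ[A] N} (hf : Function.Surjective f) :
    Function.Injective (map e E f) := by
  intro g h hgh
  ext y
  obtain ⟨x, rfl⟩ := hf y
  exact DFunLike.congr_fun hgh x

theorem map_surjective [Module.Injective k E] {f : M →ₗ[A] N} (hf : Function.Injective f) :
    Function.Surjective (map e E f) :=
  fun g => Module.Injective.extension_property k E _ _ (f.restrictScalars k) hf g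

theorem exact_map {L : Type u} [AddCommGroup L] [Module k L] [Module A L] [IsScalarTower k A L]
    {f : M →ₗ[A] N} {g : N →ₗ[A] L} (hg : Function.Surjective g) (h : Function.Exact f g) :
    Function.Exact (map e E g) (map e E f) := by
  intro φ
  constructor
  · intro hφ
    have hker (y : N) (hy : g y = 0) : φ y = 0 := by
      obtain ⟨x, rfl⟩ := (h y).1 hy
      exact DFunLike.congr_fun hφ x
    let s := Function.surjInv hg
    have hs (y : N) : φ (s (g y)) = φ y := by
      rw [← sub_eq_zero, ← map_sub]
      exact hker _ (by simp [s, Function.surjInv_eq hg])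
    refine ⟨({ toFun := fun z => φ (s z), map_add' := ?_, map_smul' := ?_ } : L →ₗ[k] E), ?_⟩
    · intro z w
      obtain ⟨z, rfl⟩ := hg z
      obtain ⟨w, rfl⟩ := hg w
      rw [← map_add, hs, hs, hs, map_add]
    · intro c z
      obtain ⟨z, rfl⟩ := hg z
      rw [← LinearMap.map_smul_of_tower, hs, hs, map_smul, RingHom.id_apply]
    · exact ext hs
  · rintro ⟨ψ, rfl⟩
    ext x
    simp [h.apply_apply_eq_zero]

/-- The adjunction between the dualities on `A`-modules and on `B`-modules. -/
def swap (h : ∀ b, unop (e' (unop (e b))) = b) (φ : M →ₗ[A] MatlisDual e' E X) :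
    X →ₗ[B] MatlisDual e E M where
  toFun x :=
    { toFun := fun m => φ m x
      map_add' := by simp
      map_smul' := fun c m => by rw [φ.map_smul_of_tower]; simp }
  map_add' x y := by
    refine LinearMap.ext fun m => ?_
    exact map_add (φ m) x y
  map_smul' b x := by
    refine LinearMap.ext fun m => ?_
    change φ m (b • x) = φ (unop (e b) • m) x
    rw [φ.map_smul, algebra_smul_apply, h]

@[simp]
theorem swap_apply (h : ∀ b, unop (e' (unop (e b))) = b) (φ : M →ₗ[A] MatlisDual e' E X)
    (x : X) (m : M) : swap h φ x m = φ m x := rfl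

theorem injective_of_projective [Module.Injective k E] (h : ∀ b, unop (e' (unop (e b))) = b)
    (h' : ∀ a, unop (e (unop (e' a))) = a) [Module.Projective A M] :
    Module.Injective B (MatlisDual e E M) where
  out X Y _ _ _ _ f hf g := by
    let := Module.restrictScalars k B X
    let := Module.restrictScalars k B Y
    have := IsScalarTower.restrictScalars k B X
    have := IsScalarTower.restrictScalars k B Y
    obtain ⟨φ, hφ⟩ := Module.projective_lifting_property (map e' E f) (swap h' g)
      (map_surjective hf)
    refine ⟨swap h φ, fun x => ext fun m => ?_⟩
    exact DFunLike.congr_fun (LinearMap.congr_fun hφ m) x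

theorem finite (hE : IsMinimalInjectiveCogenerator k E) [IsArtinianRing k] [Module.Finite k M] :
    Module.Finite B (MatlisDual e E M) := by
  have : IsNoetherian k (M →ₗ[k] E) := (isFiniteLength_iff_isNoetherian_isArtinian.1
    (hE.isFiniteLength_hom
      (isFiniteLength_iff_isNoetherian_isArtinian.2 ⟨inferInstance, inferInstance⟩))).1
  have : Module.Finite k (MatlisDual e E M) := inferInstanceAs (Module.Finite k (M →ₗ[k] E))
  exact Module.Finite.of_restrictScalars_finite k B _

/-- Biduality for finite modules. -/
theorem nonempty_linearEquiv (hE : IsMinimalInjectiveCogenerator k E) [IsArtinianRing k]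
    [Module.Finite k M] (h' : ∀ a, unop (e (unop (e' a))) = a) :
    Nonempty (M ≃ₗ[A] MatlisDual e' E (MatlisDual e E M)) :=
  ⟨LinearEquiv.ofBijective (swap h' LinearMap.id) (hE.bijective_applyₗ
    (isFiniteLength_iff_isNoetherian_isArtinian.2 ⟨inferInstance, inferInstance⟩))⟩

theorem subsingleton_ext_iff [Module.Injective k E] (h : ∀ b, unop (e' (unop (e b))) = b)
    (h' : ∀ a, unop (e (unop (e' a))) = a) (n : ℕ)
    (M : Type u) [AddCommGroup M] [Module k M] [Module A M] [IsScalarTower k A M]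
    (X : Type u) [AddCommGroup X] [Module k X] [Module B X] [IsScalarTower k B X] :
    Subsingleton (Abelian.Ext.{u} (ModuleCat.of A M) (ModuleCat.of A (MatlisDual e' E X)) (n + 1)) ↔
      Subsingleton
        (Abelian.Ext.{u} (ModuleCat.of B X) (ModuleCat.of B (MatlisDual e E M)) (n + 1)) := by
  let π : (M →₀ A) →ₗ[A] M := Finsupp.linearCombination A id
  have hπ : Function.Surjective π := Finsupp.linearCombination_id_surjective A M
  let ι : LinearMap.ker π →ₗ[A] M →₀ A := (LinearMap.ker π).subtype
  have hι : Function.Injective ι := Subtype.val_injective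
  have hex : Function.Exact ι π := LinearMap.exact_subtype_ker_map π
  have hS := LinearMap.shortExact_shortComplexKer hπ
  let π' : MatlisDual e E M →ₗ[B] MatlisDual e E (M →₀ A) := map e E π
  let ι' : MatlisDual e E (M →₀ A) →ₗ[B] MatlisDual e E (LinearMap.ker π) := map e E ι
  have hDex : Function.Exact π' ι' := exact_map hπ hex
  let T : ShortComplex (ModuleCat.{u} B) := ModuleCat.shortComplexOfCompEqZero
    π' ι' hDex.linearMap_comp_eq_zero
  have hT : T.ShortExact := ModuleCat.shortComplex_shortExact T hDex
    (map_injective hπ) (map_surjective hι)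
  have : Projective π.shortComplexKer.X₂ :=
    (IsProjective.iff_projective (R := A) (M →₀ A)).1 inferInstance
  have : Injective T.X₂ := (Module.injective_iff_injective_object B (MatlisDual e E (M →₀ A))).1
    (injective_of_projective h h')
  cases n with
  | zero =>
    refine (subsingleton_ext_one_iff_of_projective hS _).trans (Iff.trans ?_
      (subsingleton_ext_one_iff_of_injective hT (ModuleCat.of B X)).symm)
    constructor
    · intro H f
      let φ : X →ₗ[B] MatlisDual e E (LinearMap.ker π) := f.hom
      obtain ⟨g, hg⟩ := H (ModuleCat.ofHom (swap h' φ))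
      let ψ : (M →₀ A) →ₗ[A] MatlisDual e' E X := g.hom
      refine ⟨ModuleCat.ofHom (swap h ψ), ?_⟩
      ext x
      refine ext (e := e) (E := E) (M := LinearMap.ker π) fun m => ?_
      exact DFunLike.congr_fun (LinearMap.congr_fun (congrArg ModuleCat.Hom.hom hg) m) x
    · intro H f
      let φ : LinearMap.ker π →ₗ[A] MatlisDual e' E X := f.hom
      obtain ⟨g, hg⟩ := H (ModuleCat.ofHom (swap h φ))
      let ψ : X →ₗ[B] MatlisDual e E (M →₀ A) := g.hom
      refine ⟨ModuleCat.ofHom (swap h' ψ), ?_⟩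
      ext m
      refine ext (e := e') (E := E) (M := X) fun x => ?_
      exact DFunLike.congr_fun (LinearMap.congr_fun (congrArg ModuleCat.Hom.hom hg) x) m
  | succ n =>
    exact (subsingleton_ext_succ_iff_of_projective hS _ n).trans
      ((subsingleton_ext_iff h h' n (LinearMap.ker π) X).trans
      (subsingleton_ext_succ_iff_of_injective hT (ModuleCat.of B X) n).symm)
termination_by n

end MatlisDual

end MatlisDual

theorem SatisfiesUAC.of_antiIso {k A B : Type u} [CommRing k] [IsArtinianRing k] [Ring A]
    [Algebra k A] [Module.Finite k A] [Ring B] [Algebra k B] [Module.Finite k B]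
    (e : B ≃ₐ[k] Aᵐᵒᵖ) (e' : A ≃ₐ[k] Bᵐᵒᵖ) (h : ∀ b, (e' (e b).unop).unop = b)
    (h' : ∀ a, (e (e' a).unop).unop = a) (hA : SatisfiesUAC A) : SatisfiesUAC B := by
  obtain ⟨E, _, _, hE⟩ := exists_isMinimalInjectiveCogenerator k
  have := hE.injective
  obtain ⟨b, hb⟩ := hA
  refine ⟨b, fun X Y hX hY ⟨n, hn⟩ i hi => ?_⟩
  let := Module.restrictScalars k B X
  let := Module.restrictScalars k B Y
  have := IsScalarTower.restrictScalars k B X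
  have := IsScalarTower.restrictScalars k B Y
  have : Module.Finite k X := Module.Finite.trans B X
  have : Module.Finite k Y := Module.Finite.trans B Y
  let M := ModuleCat.of A (MatlisDual e' E Y)
  let N := ModuleCat.of A (MatlisDual e' E X)
  have key (j : ℕ) :
      Subsingleton (ExtGroup M N (j + 1)) ↔ Subsingleton (ExtGroup X Y (j + 1)) := by
    obtain ⟨φ⟩ := MatlisDual.nonempty_linearEquiv (M := Y) (e := e') (e' := e) hE h
    rw [subsingleton_extGroup_succ_iff, MatlisDual.subsingleton_ext_iff h h',
      ← subsingleton_extGroup_succ_iff]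
    exact ((forget _).mapIso (((Ext ℤ _ (j + 1)).obj (Opposite.op X)).mapIso
      φ.toModuleIso)).toEquiv.subsingleton_congr.symm
  obtain ⟨i, rfl⟩ : ∃ j, i = j + 1 := ⟨i - 1, by lia⟩
  refine (key i).1 (hb M N (MatlisDual.finite hE) (MatlisDual.finite hE) ⟨n + 1, fun j hj => ?_⟩ _ hi)
  obtain ⟨j, rfl⟩ : ∃ l, j = l + 1 := ⟨j - 1, by lia⟩
  exact (key j).2 (hn _ (by lia))

/-- For an Artin algebra `Λ` over a commutative artinian ring `k`, the uniform
Auslander condition holds for `Λ` if and only if it holds for the opposite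
algebra `Λᵐᵒᵖ`. -/
theorem stmt2 (k : Type u) (Λ : Type u) [CommRing k] [IsArtinianRing k]
    [Ring Λ] [Algebra k Λ] [Module.Finite k Λ] :
    SatisfiesUAC Λ ↔ SatisfiesUAC Λᵐᵒᵖ :=
  ⟨.of_antiIso (k := k) AlgEquiv.refl (AlgEquiv.opOp k Λ) (fun _ => rfl) (fun _ => rfl),
    .of_antiIso (k := k) (AlgEquiv.opOp k Λ) AlgEquiv.refl (fun _ => rfl) (fun _ => rfl)⟩
end

section
/- Let A and B be left-noetherian rings. Then the product ring A × B satisfies the uniform Auslander condition (UAC) if and only if both A and B satisfy (UAC). -/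
open CategoryTheory

universe u

section ExtVanishing

open Opposite

/-- `Ext` in positive degree vanishes iff every cocycle of a projective resolution is a
coboundary. -/
lemma subsingleton_ext_succ_iff {k C : Type*} [Ring k] [Category* C] [Abelian C] [Linear k C]
    [EnoughProjectives C] {X : C} (P : ProjectiveResolution X) (Y : C) (n : ℕ) :
    Subsingleton (((Ext k C (n + 1)).obj (op X)).obj Y) ↔
      ∀ f : P.complex.X (n + 1) ⟶ Y, P.complex.d (n + 2) (n + 1) ≫ f = 0 →
        ∃ g : P.complex.X n ⟶ Y, P.complex.d (n + 1) n ≫ g = f := by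
  rw [← ModuleCat.isZero_iff_subsingleton, (P.isoExt (n + 1) Y).isZero_iff,
    ← HomologicalComplex.exactAt_iff_isZero_homology,
    HomologicalComplex.exactAt_iff' _ n (n + 1) (n + 2) (by simp) (by simp),
    ShortComplex.moduleCat_exact_iff]
  rfl

/-- If two exact functors preserve projective objects and together identify `X ⟶ Y` with the
product of the corresponding groups of morphisms, then `Ext` in positive degree vanishes iff it
vanishes after applying each of the functors. -/
lemma subsingleton_ext_succ_iff_and {k C D E : Type*} [Ring k]
    [Category* C] [Abelian C] [Linear k C] [EnoughProjectives C]
    [Category* D] [Abelian D] [Linear k D] [EnoughProjectives D]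
    [Category* E] [Abelian E] [Linear k E] [EnoughProjectives E]
    (F : C ⥤ D) [F.Additive] [F.PreservesHomology] [F.PreservesProjectiveObjects]
    (G : C ⥤ E) [G.Additive] [G.PreservesHomology] [G.PreservesProjectiveObjects]
    (faithful : ∀ {X Y : C} (f g : X ⟶ Y), F.map f = F.map g → G.map f = G.map g → f = g)
    (full : ∀ {X Y : C} (f : F.obj X ⟶ F.obj Y) (g : G.obj X ⟶ G.obj Y),
      ∃ h : X ⟶ Y, F.map h = f ∧ G.map h = g)
    (X Y : C) (n : ℕ) :
    Subsingleton (((Ext k C (n + 1)).obj (op X)).obj Y) ↔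
      Subsingleton (((Ext k D (n + 1)).obj (op (F.obj X))).obj (F.obj Y)) ∧
      Subsingleton (((Ext k E (n + 1)).obj (op (G.obj X))).obj (G.obj Y)) := by
  let P := ProjectiveResolution.of X
  rw [subsingleton_ext_succ_iff P, subsingleton_ext_succ_iff (F.mapProjectiveResolution P),
    subsingleton_ext_succ_iff (G.mapProjectiveResolution P)]
  change _ ↔
    (∀ f : F.obj (P.complex.X (n + 1)) ⟶ F.obj Y, F.map (P.complex.d (n + 2) (n + 1)) ≫ f = 0 →
      ∃ g : F.obj (P.complex.X n) ⟶ F.obj Y, F.map (P.complex.d (n + 1) n) ≫ g = f) ∧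
    (∀ f : G.obj (P.complex.X (n + 1)) ⟶ G.obj Y, G.map (P.complex.d (n + 2) (n + 1)) ≫ f = 0 →
      ∃ g : G.obj (P.complex.X n) ⟶ G.obj Y, G.map (P.complex.d (n + 1) n) ≫ g = f)
  refine ⟨fun H ↦ ⟨fun f hf ↦ ?_, fun f hf ↦ ?_⟩, fun ⟨HF, HG⟩ f hf ↦ ?_⟩
  · obtain ⟨h, rfl, hG⟩ := full f 0
    obtain ⟨g, rfl⟩ := H h (faithful _ _ (by simpa using hf) (by simp [hG]))
    exact ⟨F.map g, (F.map_comp _ _).symm⟩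
  · obtain ⟨h, hF, rfl⟩ := full 0 f
    obtain ⟨g, rfl⟩ := H h (faithful _ _ (by simp [hF]) (by simpa using hf))
    exact ⟨G.map g, (G.map_comp _ _).symm⟩
  · obtain ⟨g₁, h₁⟩ := HF (F.map f) (by rw [← F.map_comp, hf, F.map_zero])
    obtain ⟨g₂, h₂⟩ := HG (G.map f) (by rw [← G.map_comp, hf, G.map_zero])
    obtain ⟨g, rfl, rfl⟩ := full g₁ g₂
    exact ⟨g, faithful _ _ (by rw [F.map_comp, h₁]) (by rw [G.map_comp, h₂])⟩

lemma subsingleton_ext_iff_of_iso {k C : Type*} [Ring k] [Category* C] [Abelian C] [Linear k C]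
    [EnoughProjectives C] {X X' Y Y' : C} (e : X ≅ X') (e' : Y ≅ Y') (n : ℕ) :
    Subsingleton (((Ext k C n).obj (op X)).obj Y) ↔
      Subsingleton (((Ext k C n).obj (op X')).obj Y') := by
  simp only [← ModuleCat.isZero_iff_subsingleton]
  exact (((Ext k C n).mapIso e.symm.op).app Y ≪≫
    ((Ext k C n).obj (op X')).mapIso e').isZero_iff

lemma subsingleton_ext_succ_of_isZero {k C : Type*} [Ring k] [Category* C] [Abelian C] [Linear k C]
    [EnoughProjectives C] {X : C} (hX : Limits.IsZero X) (Y : C) (n : ℕ) :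
    Subsingleton (((Ext k C (n + 1)).obj (op X)).obj Y) :=
  have := hX.projective
  ModuleCat.isZero_iff_subsingleton.mp (isZero_Ext_succ_of_projective X Y n)

end ExtVanishing

/-- The data exhibiting `S` as a direct factor of the ring `R`. -/
structure RingFactor (R S : Type*) [Ring R] [Ring S] where
  /-- The projection. -/
  proj : R →+* S
  /-- The non-unital inclusion. -/
  incl : S →ₙ+* R
  proj_incl (x : S) : proj (incl x) = x
  incl_proj (r : R) : incl (proj r) = incl 1 * r
  incl_one_mul (r : R) : incl 1 * r = r * incl 1

namespace RingFactor

variable {R S : Type u} [Ring R] [Ring S] (D : RingFactor R S)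

lemma incl_one_mul_incl (x : S) : D.incl 1 * D.incl x = D.incl x := by
  rw [← map_mul, one_mul]

lemma incl_one_smul_incl_smul {M : Type*} [AddCommGroup M] [Module R M] (x : S) (m : M) :
    D.incl 1 • D.incl x • m = D.incl x • m := by
  rw [← mul_smul, incl_one_mul_incl]

/-- The part of an `R`-module on which the idempotent of the factor `S` acts as the identity. -/
def part (M : Type*) [AddCommGroup M] [Module R M] : Submodule R M where
  carrier := {m | D.incl 1 • m = m}
  add_mem' {a b} ha hb := by
    rw [Set.mem_ofPred_eq] at *
    rw [smul_add, ha, hb]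
  zero_mem' := smul_zero _
  smul_mem' r m hm := by
    rw [Set.mem_ofPred_eq] at *
    rw [← mul_smul, D.incl_one_mul, mul_smul, hm]

section Part

variable {M N : Type*} [AddCommGroup M] [Module R M] [AddCommGroup N] [Module R N]

lemma mem_part {m : M} : m ∈ D.part M ↔ D.incl 1 • m = m := Iff.rfl

lemma incl_smul_mem_part (x : S) (m : M) : D.incl x • m ∈ D.part M :=
  D.incl_one_smul_incl_smul x m

instance partModule : Module S (D.part M) where
  smul x m := ⟨D.incl x • (m : M), D.incl_smul_mem_part x (m : M)⟩
  one_smul m := Subtype.ext m.2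
  mul_smul x y m := Subtype.ext (by
    change D.incl (x * y) • (m : M) = D.incl x • D.incl y • (m : M)
    rw [map_mul, mul_smul])
  smul_zero x := Subtype.ext (smul_zero (D.incl x))
  smul_add x m n := Subtype.ext (smul_add (D.incl x) (m : M) n)
  add_smul x y m := Subtype.ext (by
    change D.incl (x + y) • (m : M) = D.incl x • (m : M) + D.incl y • (m : M)
    rw [map_add, add_smul])
  zero_smul m := Subtype.ext (by
    change D.incl 0 • (m : M) = 0
    rw [map_zero, zero_smul])

lemma proj_smul_part (r : R) (m : D.part M) : D.proj r • m = r • m :=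
  Subtype.ext (by
    change D.incl (D.proj r) • (m : M) = r • (m : M)
    rw [incl_proj, incl_one_mul, mul_smul, D.mem_part.mp m.2])

/-- The projection of an `R`-module onto its `S`-part. -/
def toPart : M →ₗ[R] D.part M where
  toFun m := ⟨D.incl 1 • m, D.incl_smul_mem_part 1 m⟩
  map_add' a b := Subtype.ext (smul_add _ a b)
  map_smul' r a := Subtype.ext (by
    change D.incl 1 • r • a = r • D.incl 1 • a
    rw [← mul_smul, incl_one_mul, mul_smul])

lemma toPart_coe (m : D.part M) : D.toPart (m : M) = m := Subtype.ext m.2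

lemma finite_part [Module.Finite R M] : Module.Finite S (D.part M) := by
  have : Module.Finite R (D.part M) :=
    Module.Finite.of_surjective D.toPart fun m ↦ ⟨m, D.toPart_coe m⟩
  have : RingHomSurjective D.proj := ⟨fun x ↦ ⟨_, D.proj_incl x⟩⟩
  let f : D.part M →ₛₗ[D.proj] D.part M :=
    { AddMonoidHom.id _ with map_smul' := fun r m ↦ (D.proj_smul_part r m).symm }
  exact Module.Finite.of_surjective f Function.surjective_id

/-- The map induced on `S`-parts by an `R`-linear map. -/
def partMap (f : M →ₗ[R] N) : D.part M →ₗ[S] D.part N where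
  toFun m := ⟨f m, by rw [mem_part, ← map_smul, D.mem_part.mp m.2]⟩
  map_add' a b := Subtype.ext (map_add f (a : M) b)
  map_smul' x a := Subtype.ext (map_smul f (D.incl x) (a : M))

/-- An `S`-linear map between `S`-parts, extended by zero to an `R`-linear map. -/
def extend (f : D.part M →ₗ[S] D.part N) : M →ₗ[R] N where
  toFun m := f (D.toPart m)
  map_add' a b := by simp
  map_smul' r a := by
    rw [map_smul, ← proj_smul_part, map_smul, proj_smul_part]
    rfl

lemma extend_apply (f : D.part M →ₗ[S] D.part N) (m : M) :
    D.extend f m = f (D.toPart m) := rfl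

end Part

/-- Taking the `S`-part, as a functor from `R`-modules to `S`-modules. -/
def functor : ModuleCat.{u} R ⥤ ModuleCat.{u} S where
  obj M := ModuleCat.of S (D.part M)
  map f := ModuleCat.ofHom (D.partMap f.hom)

instance : D.functor.Additive where
  map_add := rfl

instance : D.functor.PreservesHomology := by
  refine ((D.functor.exact_tfae).out 1 2).mp fun K hK ↦ ?_
  rw [ShortComplex.moduleCat_exact_iff] at hK ⊢
  intro (x : D.part K.X₂) hx
  obtain ⟨y, hy⟩ := hK x (congrArg (Subtype.val : D.part K.X₃ → K.X₃) hx)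
  refine ⟨D.toPart y, Subtype.ext ?_⟩
  change K.f.hom (D.incl 1 • y) = (x : K.X₂)
  rw [map_smul, ← D.mem_part.mp x.2]
  exact congrArg _ hy

instance : D.functor.PreservesProjectiveObjects where
  projective_obj {P} hP := by
    refine ⟨fun {X Y} f e he ↦ ?_⟩
    let res := ModuleCat.restrictScalars.{u} D.proj
    let f' : P ⟶ res.obj Y := ModuleCat.ofHom (Y := res.obj Y)
      { toFun := fun m ↦ f.hom (D.toPart m)
        map_add' := fun a b ↦ by rw [map_add]; exact map_add f.hom _ _
        map_smul' := fun r a ↦ by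
          rw [map_smul, ← proj_smul_part]
          exact map_smul f.hom _ _ }
    have : Epi (res.map e) := (ModuleCat.epi_iff_surjective _).mpr
      ((ModuleCat.epi_iff_surjective e).mp he)
    let h := Projective.factorThru f' (res.map e)
    have hh (m : P) : e.hom (h.hom m) = f.hom (D.toPart m) :=
      congrArg (fun g : P ⟶ res.obj Y ↦ g.hom m) (Projective.factorThru_comp f' (res.map e))
    refine ⟨ModuleCat.ofHom (X := D.part P)
      { toFun := fun m ↦ h.hom (m : P)
        map_add' := fun a b ↦ map_add h.hom (a : P) b
        map_smul' := fun x a ↦ ?_ }, ?_⟩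
    · have := map_smul h.hom (D.incl x) (a : P)
      rw [ModuleCat.restrictScalars.smul_def, proj_incl] at this
      exact this
    · ext m
      exact (hh (m : D.part P).1).trans (congrArg f.hom (D.toPart_coe m))

/-- A module restricted along the projection is its own part. -/
noncomputable def functorRestrictScalarsIso (M : ModuleCat.{u} S) :
    D.functor.obj ((ModuleCat.restrictScalars D.proj).obj M) ≅ M :=
  LinearEquiv.toModuleIso
    (X₁ := D.part ((ModuleCat.restrictScalars D.proj).obj M))
    { toFun := fun m ↦ m.1
      invFun := fun m ↦ ⟨m, by
        change D.proj (D.incl 1) • m = m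
        rw [proj_incl, one_smul]⟩
      map_add' := fun _ _ ↦ rfl
      map_smul' := fun x m ↦ by
        change D.proj (D.incl x) • (show M from m.1) = _
        rw [proj_incl]
        rfl
      left_inv := fun _ ↦ rfl
      right_inv := fun _ ↦ rfl }

lemma finite_restrictScalars (M : ModuleCat.{u} S) (hM : Module.Finite S M) :
    Module.Finite R ((ModuleCat.restrictScalars D.proj).obj M) := by
  obtain ⟨s, hs⟩ := hM.fg_top
  let N : Submodule R ((ModuleCat.restrictScalars D.proj).obj M) := Submodule.span R (s : Set M)
  suffices h : ∀ m ∈ Submodule.span S (s : Set M), m ∈ N from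
    ⟨⟨s, eq_top_iff.mpr fun m _ ↦ h m (hs ▸ Submodule.mem_top)⟩⟩
  intro m hm
  induction hm using Submodule.span_induction with
  | mem x h => exact Submodule.subset_span h
  | zero => exact zero_mem N
  | add x y _ _ hx hy => exact add_mem hx hy
  | smul a x _ hx =>
    have : D.proj (D.incl a) • x ∈ N := N.smul_mem (D.incl a) hx
    rwa [proj_incl] at this

section Complementary

variable {T : Type u} [Ring T] (E : RingFactor R T)

lemma incl_one_smul_add (hDE : D.incl 1 + E.incl 1 = 1)
    {M : Type*} [AddCommGroup M] [Module R M] (m : M) :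
    D.incl 1 • m + E.incl 1 • m = m := by
  rw [← add_smul, hDE, one_smul]

lemma incl_one_smul_eq_zero (hDE : D.incl 1 + E.incl 1 = 1)
    {M : Type*} [AddCommGroup M] [Module R M] (m : E.part M) :
    D.incl 1 • (m : M) = 0 := by
  have := D.incl_one_smul_add E hDE (m : M)
  rwa [E.mem_part.mp m.2, add_eq_right] at this

lemma toPart_eq_zero (hDE : D.incl 1 + E.incl 1 = 1)
    {M : Type*} [AddCommGroup M] [Module R M] (m : E.part M) :
    D.toPart (m : M) = 0 :=
  Subtype.ext (D.incl_one_smul_eq_zero E hDE m)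

lemma isZero_functor_restrictScalars (hDE : D.incl 1 + E.incl 1 = 1) (M : ModuleCat.{u} T) :
    Limits.IsZero (D.functor.obj ((ModuleCat.restrictScalars E.proj).obj M)) := by
  rw [ModuleCat.isZero_iff_subsingleton]
  refine subsingleton_of_forall_eq
    (0 : D.part ((ModuleCat.restrictScalars E.proj).obj M)) fun m ↦ Subtype.ext ?_
  let m' := (E.functorRestrictScalarsIso M).inv m.1
  rw [← D.mem_part.mp m.2]
  exact D.incl_one_smul_eq_zero E hDE m'

lemma functor_map_ext (hDE : D.incl 1 + E.incl 1 = 1) {X Y : ModuleCat.{u} R} (f g : X ⟶ Y)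
    (h₁ : D.functor.map f = D.functor.map g) (h₂ : E.functor.map f = E.functor.map g) :
    f = g := by
  ext m
  have h₁ := congrArg (Subtype.val : D.part Y → Y)
    (LinearMap.congr_fun (ModuleCat.hom_ext_iff.mp h₁) (D.toPart m))
  have h₂ := congrArg (Subtype.val : E.part Y → Y)
    (LinearMap.congr_fun (ModuleCat.hom_ext_iff.mp h₂) (E.toPart m))
  change f.hom (D.incl 1 • m) = g.hom (D.incl 1 • m) at h₁
  change f.hom (E.incl 1 • m) = g.hom (E.incl 1 • m) at h₂
  rw [← D.incl_one_smul_add E hDE m, map_add, map_add, h₁, h₂]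

lemma exists_functor_map_eq (hDE : D.incl 1 + E.incl 1 = 1)
    {X Y : ModuleCat.{u} R} (f : D.functor.obj X ⟶ D.functor.obj Y)
    (g : E.functor.obj X ⟶ E.functor.obj Y) :
    ∃ h : X ⟶ Y, D.functor.map h = f ∧ E.functor.map h = g := by
  have hED : E.incl 1 + D.incl 1 = 1 := by rw [add_comm, hDE]
  let f' : D.part X →ₗ[S] D.part Y := f.hom
  let g' : E.part X →ₗ[T] E.part Y := g.hom
  refine ⟨ModuleCat.ofHom (D.extend f' + E.extend g'), ?_, ?_⟩
  · ext (m : D.part X)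
    refine Subtype.ext ?_
    change (D.extend f' + E.extend g') (m : X) = f' m
    rw [LinearMap.add_apply, extend_apply, extend_apply, toPart_coe,
      E.toPart_eq_zero D hED, map_zero, Submodule.coe_zero, add_zero]
  · ext (m : E.part X)
    refine Subtype.ext ?_
    change (D.extend f' + E.extend g') (m : X) = g' m
    rw [LinearMap.add_apply, extend_apply, extend_apply, toPart_coe,
      D.toPart_eq_zero E hDE, map_zero, Submodule.coe_zero, zero_add]

lemma subsingleton_extGroup_succ_iff (hDE : D.incl 1 + E.incl 1 = 1)
    (M N : ModuleCat.{u} R) (n : ℕ) :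
    Subsingleton (ExtGroup M N (n + 1)) ↔
      Subsingleton (ExtGroup (D.functor.obj M) (D.functor.obj N) (n + 1)) ∧
      Subsingleton (ExtGroup (E.functor.obj M) (E.functor.obj N) (n + 1)) :=
  subsingleton_ext_succ_iff_and D.functor E.functor (D.functor_map_ext E hDE)
    (D.exists_functor_map_eq E hDE) M N n

lemma subsingleton_extGroup_restrictScalars_succ_iff (hDE : D.incl 1 + E.incl 1 = 1)
    (M N : ModuleCat.{u} S) (n : ℕ) :
    Subsingleton (ExtGroup ((ModuleCat.restrictScalars D.proj).obj M)
      ((ModuleCat.restrictScalars D.proj).obj N) (n + 1)) ↔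
      Subsingleton (ExtGroup M N (n + 1)) := by
  rw [D.subsingleton_extGroup_succ_iff E hDE, subsingleton_ext_iff_of_iso
    (D.functorRestrictScalarsIso M) (D.functorRestrictScalarsIso N)]
  exact and_iff_left (subsingleton_ext_succ_of_isZero
    (E.isZero_functor_restrictScalars D (by rw [add_comm, hDE]) M) _ n)

end Complementary

end RingFactor

lemma satisfiesUAC_iff_succ (A : Type u) [Ring A] :
    SatisfiesUAC A ↔ ∃ b : ℕ, ∀ M N : ModuleCat.{u} A, Module.Finite A M → Module.Finite A N →
      (∃ n : ℕ, ∀ i ≥ n, Subsingleton (ExtGroup M N (i + 1))) →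
      ∀ i ≥ b, Subsingleton (ExtGroup M N (i + 1)) := by
  refine exists_congr fun b ↦ forall₄_congr fun M N _ _ ↦ imp_congr ?_ ?_
  · refine ⟨fun ⟨n, hn⟩ ↦ ⟨n, fun i hi ↦ hn _ (by lia)⟩, fun ⟨n, hn⟩ ↦ ⟨n + 1, fun i hi ↦ ?_⟩⟩
    obtain ⟨j, rfl⟩ := Nat.exists_eq_add_of_le' (show 1 ≤ i by lia)
    exact hn j (by lia)
  · refine ⟨fun h i hi ↦ h _ (by lia), fun h i hi ↦ ?_⟩
    obtain ⟨j, rfl⟩ := Nat.exists_eq_add_of_le' (show 1 ≤ i by lia)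
    exact h j (by lia)

namespace RingFactor

variable {R S T : Type u} [Ring R] [Ring S] [Ring T] (D : RingFactor R S) (E : RingFactor R T)

lemma satisfiesUAC_left (hDE : D.incl 1 + E.incl 1 = 1) (h : SatisfiesUAC R) : SatisfiesUAC S := by
  rw [satisfiesUAC_iff_succ] at h ⊢
  obtain ⟨b, hb⟩ := h
  refine ⟨b, fun M N hM hN ↦ ?_⟩
  simpa only [D.subsingleton_extGroup_restrictScalars_succ_iff E hDE] using
    hb _ _ (D.finite_restrictScalars M hM) (D.finite_restrictScalars N hN)

lemma satisfiesUAC_iff (hDE : D.incl 1 + E.incl 1 = 1) :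
    SatisfiesUAC R ↔ SatisfiesUAC S ∧ SatisfiesUAC T := by
  refine ⟨fun h ↦ ⟨D.satisfiesUAC_left E hDE h,
    E.satisfiesUAC_left D (by rw [add_comm, hDE]) h⟩, ?_⟩
  simp only [satisfiesUAC_iff_succ]
  rintro ⟨⟨b, hb⟩, ⟨c, hc⟩⟩
  refine ⟨max b c, fun M N hM hN ⟨n, hn⟩ i hi ↦ ?_⟩
  simp only [D.subsingleton_extGroup_succ_iff E hDE] at hn ⊢
  exact ⟨hb _ _ D.finite_part D.finite_part ⟨n, fun j hj ↦ (hn j hj).1⟩ i (by lia),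
    hc _ _ E.finite_part E.finite_part ⟨n, fun j hj ↦ (hn j hj).2⟩ i (by lia)⟩

end RingFactor

/-- `A` as a factor of `A × B`. -/
def RingFactor.fst (A B : Type*) [Ring A] [Ring B] : RingFactor (A × B) A where
  proj := RingHom.fst A B
  incl :=
    { toFun := fun a ↦ (a, 0)
      map_zero' := rfl
      map_add' := by simp
      map_mul' := by simp }
  proj_incl _ := rfl
  incl_proj _ := Prod.ext (one_mul _).symm (zero_mul _).symm
  incl_one_mul _ := Prod.ext ((one_mul _).trans (mul_one _).symm)
    ((zero_mul _).trans (mul_zero _).symm)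

/-- `B` as a factor of `A × B`. -/
def RingFactor.snd (A B : Type*) [Ring A] [Ring B] : RingFactor (A × B) B where
  proj := RingHom.snd A B
  incl :=
    { toFun := fun b ↦ (0, b)
      map_zero' := rfl
      map_add' := by simp
      map_mul' := by simp }
  proj_incl _ := rfl
  incl_proj _ := Prod.ext (zero_mul _).symm (one_mul _).symm
  incl_one_mul _ := Prod.ext ((zero_mul _).trans (mul_zero _).symm)
    ((one_mul _).trans (mul_one _).symm)

/-- The product of two left-noetherian rings satisfies (UAC) if and only if both
factors do. -/
theorem stmt10 (A B : Type u) [Ring A] [Ring B]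
    [IsNoetherianRing A] [IsNoetherianRing B] :
    SatisfiesUAC (A × B) ↔ SatisfiesUAC A ∧ SatisfiesUAC B :=
  (RingFactor.fst A B).satisfiesUAC_iff (RingFactor.snd A B)
    (Prod.ext (add_zero _) (zero_add _))
end

section
/- Let R be a commutative noetherian ring and let I and J be proper, coprime ideals of R (i.e., I ≠ R, J ≠ R, and I + J = R). Then the quotient ring R/(I·J) satisfies Auslander's condition (AC) if and only if both R/I and R/J satisfy (AC). -/
open CategoryTheory

universe u

/-- Auslander's condition (AC). -/
def SatisfiesAC (A : Type u) [Ring A] : Prop :=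
  ∀ M : ModuleCat.{u} A, Module.Finite A M →
    ∃ b : ℕ, ∀ N : ModuleCat.{u} A, Module.Finite A N →
      (∃ n : ℕ, ∀ i ≥ n, Subsingleton (ExtGroup M N i)) →
      ∀ i > b, Subsingleton (ExtGroup M N i)

open Limits TensorProduct

lemma subsingleton_extGroup_succ_iff_s11 {A : Type u} [Ring A] {M : ModuleCat.{u} A}
    (P : ProjectiveResolution M) (N : ModuleCat.{u} A) (i : ℕ) :
    Subsingleton (ExtGroup M N (i + 1)) ↔
      ∀ φ : P.complex.X (i + 1) ⟶ N, P.complex.d (i + 2) (i + 1) ≫ φ = 0 →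
        ∃ ψ : P.complex.X i ⟶ N, P.complex.d (i + 1) i ≫ ψ = φ := by
  rw [← ModuleCat.isZero_iff_subsingleton, (P.isoExt (R := ℤ) (i + 1) N).isZero_iff,
    ← HomologicalComplex.exactAt_iff_isZero_homology,
    HomologicalComplex.exactAt_iff' _ i (i + 1) (i + 2) (by simp) (by simp),
    ShortComplex.moduleCat_exact_iff]
  rfl

lemma subsingleton_extGroup_iff_of_adjunction {S A : Type u} [Ring S] [Ring A]
    {F : ModuleCat.{u} S ⥤ ModuleCat.{u} A} {G : ModuleCat.{u} A ⥤ ModuleCat.{u} S}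
    (adj : F ⊣ G) [F.Additive] [F.PreservesHomology] [G.PreservesEpimorphisms]
    (M : ModuleCat.{u} S) (N : ModuleCat.{u} A) {i : ℕ} (hi : i ≠ 0) :
    Subsingleton (ExtGroup (F.obj M) N i) ↔ Subsingleton (ExtGroup M (G.obj N) i) := by
  obtain ⟨i, rfl⟩ := Nat.exists_eq_succ_of_ne_zero hi
  have := F.preservesProjectiveObjects_of_adjunction_of_preservesEpimorphisms adj
  let P := projectiveResolution M
  rw [subsingleton_extGroup_succ_iff_s11 P, subsingleton_extGroup_succ_iff_s11 (F.mapProjectiveResolution P)]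
  have key {a b : ℕ} (φ : F.obj (P.complex.X b) ⟶ N) :
      adj.homEquiv _ _ (F.map (P.complex.d a b) ≫ φ) = P.complex.d a b ≫ adj.homEquiv _ _ φ :=
    adj.homEquiv_naturality_left _ _
  constructor
  · intro h φ hφ
    obtain ⟨φ, rfl⟩ := (adj.homEquiv _ _).surjective φ
    rw [← key, ← adj.homAddEquiv_zero, (adj.homEquiv _ _).apply_eq_iff_eq] at hφ
    obtain ⟨ψ, hψ⟩ := h φ hφ
    exact ⟨adj.homEquiv _ _ ψ, (key _).symm.trans (congrArg _ hψ)⟩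
  · intro h φ hφ
    obtain ⟨ψ, hψ⟩ := h (adj.homEquiv _ _ φ)
      ((key _).symm.trans ((congrArg _ hφ).trans (adj.homAddEquiv_zero _ _)))
    obtain ⟨ψ, rfl⟩ := (adj.homEquiv _ _).surjective ψ
    exact ⟨ψ, (adj.homEquiv _ _).injective ((key _).trans hψ)⟩

lemma subsingleton_extGroup_of_retract {A : Type u} [Ring A] {M N N' : ModuleCat.{u} A}
    (r : Retract N' N) {i : ℕ} (hi : i ≠ 0) (h : Subsingleton (ExtGroup M N i)) :
    Subsingleton (ExtGroup M N' i) := by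
  obtain ⟨i, rfl⟩ := Nat.exists_eq_succ_of_ne_zero hi
  rw [subsingleton_extGroup_succ_iff_s11 (projectiveResolution M)] at h ⊢
  intro φ hφ
  obtain ⟨ψ, hψ⟩ := h (φ ≫ r.i) (by rw [reassoc_of% hφ, zero_comp])
  exact ⟨ψ ≫ r.r, by simp [reassoc_of% hψ]⟩

lemma subsingleton_extGroup_of_retracts {A : Type u} [Ring A] {M N N₁ N₂ : ModuleCat.{u} A}
    (r₁ : Retract N₁ N) (r₂ : Retract N₂ N) (hr : r₁.r ≫ r₁.i + r₂.r ≫ r₂.i = 𝟙 N)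
    {i : ℕ} (hi : i ≠ 0) (h₁ : Subsingleton (ExtGroup M N₁ i))
    (h₂ : Subsingleton (ExtGroup M N₂ i)) : Subsingleton (ExtGroup M N i) := by
  obtain ⟨i, rfl⟩ := Nat.exists_eq_succ_of_ne_zero hi
  rw [subsingleton_extGroup_succ_iff_s11 (projectiveResolution M)] at h₁ h₂ ⊢
  intro φ hφ
  obtain ⟨ψ₁, hψ₁⟩ := h₁ (φ ≫ r₁.r) (by rw [reassoc_of% hφ, zero_comp])
  obtain ⟨ψ₂, hψ₂⟩ := h₂ (φ ≫ r₂.r) (by rw [reassoc_of% hφ, zero_comp])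
  refine ⟨ψ₁ ≫ r₁.i + ψ₂ ≫ r₂.i, ?_⟩
  rw [Preadditive.comp_add, reassoc_of% hψ₁, reassoc_of% hψ₂, ← Preadditive.comp_add, hr,
    Category.comp_id]

lemma subsingleton_extGroup_iff_of_iso {A : Type u} [Ring A] {M M' : ModuleCat.{u} A}
    (e : M ≅ M') (N : ModuleCat.{u} A) (i : ℕ) :
    Subsingleton (ExtGroup M N i) ↔ Subsingleton (ExtGroup M' N i) := by
  rw [← ModuleCat.isZero_iff_subsingleton, ← ModuleCat.isZero_iff_subsingleton]
  exact (((Ext ℤ (ModuleCat.{u} A) i).mapIso e.op).app N).symm.isZero_iff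

section RingHom

variable {S A : Type u} [CommRing S] [CommRing A] (f : S →+* A)

instance extendScalars_additive : (ModuleCat.extendScalars.{u, u, u} f).Additive :=
  (ModuleCat.extendRestrictScalarsAdj f).left_adjoint_additive

lemma extendScalars_preservesHomology (hf : f.Flat) :
    (ModuleCat.extendScalars.{u, u, u} f).PreservesHomology := by
  algebraize [f]
  refine ((Functor.exact_tfae (ModuleCat.extendScalars.{u, u, u} f)).out 1 2).mp fun T hT ↦ ?_
  rw [ShortComplex.ShortExact.moduleCat_exact_iff_function_exact] at hT ⊢
  exact Module.Flat.lTensor_exact A hT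

lemma finite_restrictScalars (hf : f.Finite) (M : ModuleCat.{u} A) [Module.Finite A M] :
    Module.Finite S ((ModuleCat.restrictScalars f).obj M) := by
  algebraize [f]
  let : Module S M := Module.compHom M f
  have : IsScalarTower S A M := ⟨fun s a m ↦ mul_smul (f s) a m⟩
  exact Module.Finite.trans (R := S) A M

lemma finite_extendScalars (M : ModuleCat.{u} S) [Module.Finite S M] :
    Module.Finite A ((ModuleCat.extendScalars f).obj M) := by
  algebraize [f]
  exact Module.Finite.base_change S A M

/-- Extending scalars after restricting them along a surjection gives back the module. -/
noncomputable def extendRestrictIso (hf : Function.Surjective f) (M : ModuleCat.{u} A) :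
    (ModuleCat.extendScalars f).obj ((ModuleCat.restrictScalars f).obj M) ≅ M :=
  have : (ModuleCat.restrictScalars.{u} f).Full := ⟨fun {X Y} g ↦
    ⟨ModuleCat.ofHom
      { toFun := g
        map_add' := map_add g.hom
        map_smul' := fun a x ↦ by
          obtain ⟨s, rfl⟩ := hf a
          exact g.hom.map_smul s x }, rfl⟩⟩
  (asIso (ModuleCat.extendRestrictScalarsAdj f).counit).app M

lemma SatisfiesAC.of_surjective_of_flat (hS : SatisfiesAC S) (hf : Function.Surjective f)
    (hflat : f.Flat) : SatisfiesAC A := by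
  intro M hM
  have hfin : f.Finite := .of_surjective f hf
  have := extendScalars_preservesHomology f hflat
  have h (N : ModuleCat.{u} A) {i : ℕ} (hi : i ≠ 0) : Subsingleton (ExtGroup M N i) ↔
      Subsingleton (ExtGroup ((ModuleCat.restrictScalars f).obj M)
        ((ModuleCat.restrictScalars f).obj N) i) := by
    rw [← subsingleton_extGroup_iff_of_adjunction (ModuleCat.extendRestrictScalarsAdj f) _ _ hi]
    exact subsingleton_extGroup_iff_of_iso (extendRestrictIso f hf M).symm N i
  obtain ⟨b, hb⟩ := hS _ (finite_restrictScalars f hfin M)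
  refine ⟨b, fun N hN ⟨n, hn⟩ i hi ↦ (h N (by lia)).2 ?_⟩
  exact hb _ (finite_restrictScalars f hfin N)
    ⟨n + 1, fun j hj ↦ (h N (by lia)).1 (hn j (by lia))⟩ i hi

lemma flat_of_section {f : S →+* A} {σ : A →+ S} (hσ : ∀ s a, σ (f s * a) = s * σ a)
    (hfσ : ∀ a, f (σ a) = a) : f.Flat := by
  algebraize [f]
  let σ' : A →ₗ[S] S := { σ with map_smul' := fun s a ↦ hσ s a }
  exact Module.Flat.of_retract σ' (Algebra.linearMap S A) (LinearMap.ext hfσ)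

/-- An `S`-linear section of `f : S →+* A` exhibits `A ⊗[S] N` as a retract of `N`. -/
lemma exists_retract_of_section {f : S →+* A} {σ : A →+ S} (hσ : ∀ s a, σ (f s * a) = s * σ a)
    (hfσ : ∀ a, f (σ a) = a) (N : ModuleCat.{u} S) :
    ∃ r : Retract ((ModuleCat.restrictScalars f).obj ((ModuleCat.extendScalars f).obj N)) N,
      ∀ x : N, (r.r ≫ r.i) x = σ 1 • x := by
  algebraize [f]
  let σ' : A →ₗ[S] S := { σ with map_smul' := fun s a ↦ hσ s a }
  let l : TensorProduct S A N →ₗ[S] N := TensorProduct.lid S N ∘ₗ σ'.rTensor N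
  have hl (a : A) (x : N) : l (a ⊗ₜ x) = σ a • x := rfl
  have hl' (t : A ⊗[S] N) : (1 : A) ⊗ₜ[S] l t = t := by
    induction t with
    | zero => rw [map_zero, TensorProduct.tmul_zero]
    | tmul a x => rw [hl, ← TensorProduct.smul_tmul, Algebra.smul_def, mul_one,
        RingHom.algebraMap_toAlgebra, hfσ]
    | add x y hx hy => rw [map_add, TensorProduct.tmul_add, hx, hy]
  let l' : (ModuleCat.restrictScalars f).obj ((ModuleCat.extendScalars f).obj N) →ₗ[S] N :=
    { toFun := l
      map_add' := map_add l
      map_smul' := fun s x ↦ l.map_smul s x }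
  let i : (ModuleCat.restrictScalars f).obj ((ModuleCat.extendScalars f).obj N) ⟶ N :=
    ModuleCat.ofHom (X := (ModuleCat.restrictScalars f).obj ((ModuleCat.extendScalars f).obj N)) l'
  refine ⟨⟨i, (ModuleCat.extendRestrictScalarsAdj f).unit.app N, ?_⟩, fun x ↦ hl 1 x⟩
  ext x
  exact hl' x

end RingHom

section Prod

variable {S A B : Type u} [CommRing S] [CommRing A] [CommRing B]

lemma satisfiesAC_iff_of_ringEquiv_prod (e : S ≃+* A × B) :
    SatisfiesAC S ↔ SatisfiesAC A ∧ SatisfiesAC B := by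
  let f : S →+* A := (RingHom.fst A B).comp e
  let g : S →+* B := (RingHom.snd A B).comp e
  let σ : A →+ S := e.symm.toAddMonoidHom.comp (AddMonoidHom.inl A B)
  let τ : B →+ S := e.symm.toAddMonoidHom.comp (AddMonoidHom.inr A B)
  have hσ (s a) : σ (f s * a) = s * σ a := e.injective (by ext <;> simp [σ, f])
  have hτ (s b) : τ (g s * b) = s * τ b := e.injective (by ext <;> simp [τ, g])
  have hfσ (a) : f (σ a) = a := by simp [f, σ]
  have hgτ (b) : g (τ b) = b := by simp [g, τ]
  have hστ : σ 1 + τ 1 = 1 := e.injective (by ext <;> simp [σ, τ])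
  have hf : Function.Surjective f := fun a ↦ ⟨_, hfσ a⟩
  have hg : Function.Surjective g := fun b ↦ ⟨_, hgτ b⟩
  have hf' : f.Flat := flat_of_section hσ hfσ
  have hg' : g.Flat := flat_of_section hτ hgτ
  refine ⟨fun h ↦ ⟨h.of_surjective_of_flat f hf hf', h.of_surjective_of_flat g hg hg'⟩,
    fun ⟨hA, hB⟩ M hM ↦ ?_⟩
  have := extendScalars_preservesHomology f hf'
  have := extendScalars_preservesHomology g hg'
  obtain ⟨a, ha⟩ := hA _ (finite_extendScalars f M)
  obtain ⟨b, hb⟩ := hB _ (finite_extendScalars g M)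
  refine ⟨max a b, fun N hN ⟨n, hn⟩ i hi ↦ ?_⟩
  obtain ⟨r₁, hr₁⟩ := exists_retract_of_section hσ hfσ N
  obtain ⟨r₂, hr₂⟩ := exists_retract_of_section hτ hgτ N
  refine subsingleton_extGroup_of_retracts r₁ r₂ ?_ (by lia) ?_ ?_
  · ext x
    have h₁ := hr₁ x
    have h₂ := hr₂ x
    change (r₁.r ≫ r₁.i) x + (r₂.r ≫ r₂.i) x = x
    rw [h₁, h₂, ← add_smul, hστ, one_smul]
  · rw [← subsingleton_extGroup_iff_of_adjunction (ModuleCat.extendRestrictScalarsAdj f) _ _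
      (by lia)]
    refine ha _ (finite_extendScalars f N) ⟨n + 1, fun j hj ↦ ?_⟩ i (by lia)
    rw [subsingleton_extGroup_iff_of_adjunction (ModuleCat.extendRestrictScalarsAdj f) _ _
      (by lia)]
    exact subsingleton_extGroup_of_retract r₁ (by lia) (hn j (by lia))
  · rw [← subsingleton_extGroup_iff_of_adjunction (ModuleCat.extendRestrictScalarsAdj g) _ _
      (by lia)]
    refine hb _ (finite_extendScalars g N) ⟨n + 1, fun j hj ↦ ?_⟩ i (by lia)
    rw [subsingleton_extGroup_iff_of_adjunction (ModuleCat.extendRestrictScalarsAdj g) _ _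
      (by lia)]
    exact subsingleton_extGroup_of_retract r₂ (by lia) (hn j (by lia))

end Prod

/-- For proper coprime ideals `I`, `J` of a commutative noetherian ring `R`, the
quotient `R/(I·J)` satisfies (AC) if and only if both `R/I` and `R/J` do. -/
theorem stmt11 (R : Type u) [CommRing R] [IsNoetherianRing R]
    (I J : Ideal R) (hI : I ≠ ⊤) (hJ : J ≠ ⊤) (hcop : I ⊔ J = ⊤) :
    SatisfiesAC (R ⧸ (I * J)) ↔ SatisfiesAC (R ⧸ I) ∧ SatisfiesAC (R ⧸ J) :=
  satisfiesAC_iff_of_ringEquiv_prod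
    (Ideal.quotientMulEquivQuotientProd I J (Ideal.isCoprime_iff_sup_eq.mpr hcop))
end

section
/- Let A be a commutative noetherian ring and let B be a left-noetherian A-algebra that is faithfully flat as an A-module. If B satisfies Auslander's condition (AC), then A satisfies (AC). -/
open CategoryTheory

universe u

open Abelian TensorProduct

section
variable {R : Type u} [Ring R]

/-- In positive degrees, the derived functor `Ext` of `linearYoneda` and `Abelian.Ext` vanish
simultaneously. -/
lemma subsingleton_derivedExt_iff (M N : ModuleCat.{u} R) (n : ℕ) :
    Subsingleton (((Ext ℤ (ModuleCat.{u} R) (n + 1)).obj (Opposite.op M)).obj N) ↔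
      Subsingleton (Abelian.Ext.{u} M N (n + 1)) := by
  let P := ProjectiveResolution.of M
  have h : Subsingleton (((Ext ℤ (ModuleCat.{u} R) (n + 1)).obj (Opposite.op M)).obj N) ↔
      ∀ f : P.complex.X (n + 1) ⟶ N, P.complex.d (n + 2) (n + 1) ≫ f = 0 →
        ∃ g : P.complex.X n ⟶ N, P.complex.d (n + 1) n ≫ g = f := by
    rw [← ModuleCat.isZero_iff_subsingleton, (P.isoExt (n + 1) N).isZero_iff,
      ← HomologicalComplex.exactAt_iff_isZero_homology,
      HomologicalComplex.exactAt_iff' _ n (n + 1) (n + 2) (by simp) (by simp),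
      ShortComplex.moduleCat_exact_iff]
    rfl
  rw [h]
  constructor
  · intro h
    refine subsingleton_of_forall_eq 0 fun α ↦ ?_
    obtain ⟨f, hf, rfl⟩ := P.extMk_surjective α (n + 2) rfl
    exact (P.extMk_eq_zero_iff f _ rfl hf n rfl).2 (h f hf)
  · intro h f hf
    exact (P.extMk_eq_zero_iff f _ rfl hf n rfl).1 (Subsingleton.elim _ _)

variable {C : Type*} [Category* C] [Abelian C] [HasExt.{u} C] {S : ShortComplex C}
  (hS : S.ShortExact) [Projective S.X₂] (Y : C)

include hS

/-- Dimension shifting along a short exact sequence with projective middle term. -/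
lemma ShortComplex.ShortExact.subsingleton_ext_add_two_iff (n : ℕ) :
    Subsingleton (Ext.{u} S.X₃ Y (n + 2)) ↔ Subsingleton (Ext.{u} S.X₁ Y (n + 1)) := by
  constructor
  · intro h
    refine subsingleton_of_forall_eq 0 fun x ↦ ?_
    obtain ⟨y, rfl⟩ := Ext.contravariant_sequence_exact₁ hS Y x
      (add_comm 1 (n + 1)) (Subsingleton.elim (α := Ext.{u} S.X₃ Y (n + 2)) _ _)
    rw [Ext.eq_zero_of_projective y, Ext.comp_zero]
  · intro h
    refine subsingleton_of_forall_eq 0 fun x ↦ ?_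
    obtain ⟨y, rfl⟩ := Ext.contravariant_sequence_exact₃ hS Y x
      (Ext.eq_zero_of_projective _) (add_comm 1 (n + 1))
    rw [Subsingleton.elim y 0, Ext.comp_zero]

/-- `Ext¹` of the cokernel of `S.f` vanishes iff morphisms extend along `S.f`. -/
lemma ShortComplex.ShortExact.subsingleton_ext_one_iff :
    Subsingleton (Ext.{u} S.X₃ Y 1) ↔ ∀ a : S.X₁ ⟶ Y, ∃ b, S.f ≫ b = a := by
  constructor
  · intro h a
    obtain ⟨y, hy⟩ := Ext.contravariant_sequence_exact₁ hS Y (Ext.mk₀ a)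
      (add_zero 1) (Subsingleton.elim _ _)
    obtain ⟨b, rfl⟩ := (Ext.mk₀_bijective _ _).2 y
    rw [Ext.mk₀_comp_mk₀] at hy
    exact ⟨b, (Ext.mk₀_bijective _ _).1 hy⟩
  · intro h
    refine subsingleton_of_forall_eq 0 fun x ↦ ?_
    obtain ⟨y, rfl⟩ := Ext.contravariant_sequence_exact₃ hS Y x
      (Ext.eq_zero_of_projective _) (add_zero 1)
    obtain ⟨a, rfl⟩ := (Ext.mk₀_bijective _ _).2 y
    obtain ⟨b, rfl⟩ := h a
    rw [← Ext.mk₀_comp_mk₀, hS.extClass_comp_assoc]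
end

section
variable {R : Type u} [Ring R] {K F M : Type u} [AddCommGroup K] [AddCommGroup F] [AddCommGroup M]
  [Module R K] [Module R F] [Module R M] [Module.Projective R F] {f : K →ₗ[R] F} {g : F →ₗ[R] M}

/-- Dimension shifting for modules. -/
lemma subsingleton_ext_add_two_iff_of_exact (hf : Function.Injective f) (hfg : Function.Exact f g)
    (hg : Function.Surjective g) (N : ModuleCat.{u} R) (n : ℕ) :
    Subsingleton (Ext.{u} (ModuleCat.of R M) N (n + 2)) ↔
      Subsingleton (Ext.{u} (ModuleCat.of R K) N (n + 1)) := by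
  let S := ShortComplex.mk (ModuleCat.ofHom f) (ModuleCat.ofHom g) (by
    ext x; exact hfg.apply_apply_eq_zero x)
  have hS : S.ShortExact := ModuleCat.shortComplex_shortExact S hfg hf hg
  have : Projective S.X₂ := inferInstanceAs (Projective (ModuleCat.of R F))
  exact ShortComplex.ShortExact.subsingleton_ext_add_two_iff hS N n

/-- `Ext¹` computed by a projective presentation of length two. -/
lemma subsingleton_ext_one_iff_of_exact {L : Type u} [AddCommGroup L] [Module R L]
    {e : L →ₗ[R] K} {d : K →ₗ[R] F}
    (he : Function.Exact e d) (hd : Function.Exact d g)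
    (hg : Function.Surjective g) (N : Type u) [AddCommGroup N] [Module R N] :
    Subsingleton (Ext.{u} (ModuleCat.of R M) (ModuleCat.of R N) 1) ↔
      ∀ φ : K →ₗ[R] N, φ ∘ₗ e = 0 → ∃ ψ : F →ₗ[R] N, ψ ∘ₗ d = φ := by
  have hS := LinearMap.shortExact_shortComplexKer hg
  have : Projective g.shortComplexKer.X₂ := inferInstanceAs (Projective (ModuleCat.of R F))
  refine (ShortComplex.ShortExact.subsingleton_ext_one_iff hS (ModuleCat.of R N)).trans ?_
  let p : K →ₗ[R] LinearMap.ker g := d.codRestrict _ fun x ↦ hd.apply_apply_eq_zero x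
  have hp : Function.Surjective p := fun ⟨x, hx⟩ ↦ by
    obtain ⟨y, rfl⟩ := (hd x).1 hx
    exact ⟨y, rfl⟩
  have hpe : Function.Exact e p := fun x ↦ by
    rw [← he x, Subtype.ext_iff]; rfl
  constructor
  · intro h φ hφ
    obtain ⟨a, ha⟩ : ∃ a : LinearMap.ker g →ₗ[R] N, a ∘ₗ p = φ := by
      have hk : LinearMap.ker p ≤ LinearMap.ker φ := by
        rw [hpe.linearMap_ker_eq]
        exact LinearMap.range_le_ker_iff.2 hφ
      refine ⟨(LinearMap.ker p).liftQ φ hk ∘ₗ (p.quotKerEquivOfSurjective hp).symm, ?_⟩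
      ext x
      have : (p.quotKerEquivOfSurjective hp).symm (p x) = Submodule.Quotient.mk x := by
        rw [LinearEquiv.symm_apply_eq]; rfl
      simp [this]
    obtain ⟨b, hb⟩ := h (ModuleCat.ofHom a)
    refine ⟨b.hom, ?_⟩
    rw [← ha]
    ext x
    exact congr($hb (p x))
  · intro h a
    obtain ⟨ψ, hψ⟩ := h (a.hom ∘ₗ p) (by
      ext x
      change a.hom (p (e x)) = 0
      rw [hpe.apply_apply_eq_zero, map_zero])
    refine ⟨ModuleCat.ofHom ψ, ?_⟩
    ext x
    obtain ⟨y, rfl⟩ := hp x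
    exact congr($hψ y)
end

section
variable {A B : Type u} [CommRing A] [Ring B] [Algebra A B]

/-- The `B`-linear extension of an `A`-linear map to a module over a possibly noncommutative
`A`-algebra `B`. -/
noncomputable def liftBaseChangeRing {M P : Type*}
    [AddCommGroup M] [Module A M] [AddCommGroup P] [Module A P]
    [Module B P] [IsScalarTower A B P] (φ : M →ₗ[A] P) : B ⊗[A] M →ₗ[B] P :=
  AlgebraTensorModule.lift (LinearMap.toSpanSingleton B (M →ₗ[A] P) φ)

lemma liftBaseChangeRing_one_tmul {M P : Type*}
    [AddCommGroup M] [Module A M] [AddCommGroup P] [Module A P]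
    [Module B P] [IsScalarTower A B P] (φ : M →ₗ[A] P) (m : M) :
    liftBaseChangeRing φ (1 ⊗ₜ[A] m : B ⊗[A] M) = φ m := by
  simp [liftBaseChangeRing]

/-- Exactness of `Hom_B(B ⊗ -, P)` agrees with exactness of `Hom_A(-, P)`. -/
lemma forall_exists_comp_baseChange_iff {F₂ F₁ F₀ P : Type*}
    [AddCommGroup F₂] [AddCommGroup F₁] [AddCommGroup F₀]
    [Module A F₂] [Module A F₁] [Module A F₀]
    [AddCommGroup P] [Module A P]
    [Module B P] [IsScalarTower A B P] (e : F₂ →ₗ[A] F₁) (d : F₁ →ₗ[A] F₀) :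
    (∀ φ : B ⊗[A] F₁ →ₗ[B] P, φ ∘ₗ e.baseChange B = 0 →
        ∃ ψ : B ⊗[A] F₀ →ₗ[B] P, ψ ∘ₗ d.baseChange B = φ) ↔
      ∀ φ : F₁ →ₗ[A] P, φ ∘ₗ e = 0 → ∃ ψ : F₀ →ₗ[A] P, ψ ∘ₗ d = φ := by
  constructor
  · intro h φ hφ
    obtain ⟨ψ, hψ⟩ := h (liftBaseChangeRing φ) (by
      ext x
      simpa [liftBaseChangeRing_one_tmul] using congr($hφ x))
    refine ⟨ψ.restrictScalars A ∘ₗ TensorProduct.mk A B F₀ 1, ?_⟩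
    ext x
    simpa [liftBaseChangeRing_one_tmul] using congr($hψ (1 ⊗ₜ x))
  · intro h φ hφ
    obtain ⟨ψ, hψ⟩ := h (φ.restrictScalars A ∘ₗ TensorProduct.mk A B F₁ 1) (by
      ext x
      simpa using congr($hφ (1 ⊗ₜ x)))
    refine ⟨liftBaseChangeRing ψ, ?_⟩
    ext x
    simpa [liftBaseChangeRing_one_tmul] using congr($hψ x)

lemma lcomp_exact_iff {F₂ F₁ F₀ P : Type*} [AddCommGroup F₂] [AddCommGroup F₁] [AddCommGroup F₀]
    [Module A F₂] [Module A F₁] [Module A F₀]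
    [AddCommGroup P] [Module A P] (e : F₂ →ₗ[A] F₁) (d : F₁ →ₗ[A] F₀) (h : d ∘ₗ e = 0) :
    Function.Exact (LinearMap.lcomp A P d) (LinearMap.lcomp A P e) ↔
      ∀ φ : F₁ →ₗ[A] P, φ ∘ₗ e = 0 → ∃ ψ : F₀ →ₗ[A] P, ψ ∘ₗ d = φ := by
  refine ⟨fun H φ hφ ↦ (H φ).1 hφ, fun H φ ↦ ⟨H φ, ?_⟩⟩
  rintro ⟨ψ, rfl⟩
  change (ψ ∘ₗ d) ∘ₗ e = 0
  rw [LinearMap.comp_assoc, h, LinearMap.comp_zero]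

variable [Module.FaithfullyFlat A B]

/-- For finite projective modules, `Hom_A(-, B ⊗ N)` and `Hom_A(-, N)` are simultaneously exact. -/
lemma lcomp_baseChange_exact_iff {F₂ F₁ F₀ N : Type*}
    [AddCommGroup F₂] [AddCommGroup F₁] [AddCommGroup F₀]
    [Module A F₂] [Module A F₁] [Module A F₀]
    [Module.Projective A F₂] [Module.Projective A F₁] [Module.Projective A F₀]
    [Module.Finite A F₂] [Module.Finite A F₁] [Module.Finite A F₀]
    [AddCommGroup N] [Module A N] (e : F₂ →ₗ[A] F₁) (d : F₁ →ₗ[A] F₀) :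
    Function.Exact (LinearMap.lcomp A (B ⊗[A] N) d) (LinearMap.lcomp A (B ⊗[A] N) e) ↔
    Function.Exact (LinearMap.lcomp A N d) (LinearMap.lcomp A N e) := by
  rw [← Module.FaithfullyFlat.lTensor_exact_iff_exact A B]
  refine Function.Exact.iff_of_ladder_linearEquiv
    (e₁ := lTensorHomEquivHomLTensor A F₀ B N) (e₂ := lTensorHomEquivHomLTensor A F₁ B N)
    (e₃ := lTensorHomEquivHomLTensor A F₂ B N) ?_ ?_ <;>
  · ext b φ x
    simp

variable [IsNoetherianRing A]

/-- Vanishing of `Ext` is preserved and reflected by faithfully flat base change. -/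
lemma subsingleton_ext_baseChange_iff (N : Type u) [AddCommGroup N] [Module A N] (n : ℕ)
    (M : Type u) [AddCommGroup M] [Module A M] [Module.Finite A M] :
    Subsingleton (Ext.{u} (ModuleCat.of B (B ⊗[A] M)) (ModuleCat.of B (B ⊗[A] N)) (n + 1)) ↔
      Subsingleton (Ext.{u} (ModuleCat.of A M) (ModuleCat.of A N) (n + 1)) := by
  induction n generalizing M with
  | zero =>
    obtain ⟨F₀, _, _, _, _, g, hg⟩ := Module.exists_finite_presentation.{u} A M
    obtain ⟨F₁, _, _, _, _, d, hd⟩ := Module.exists_finite_presentation.{u} A (LinearMap.ker g)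
    obtain ⟨F₂, _, _, _, _, e, he⟩ := Module.exists_finite_presentation.{u} A (LinearMap.ker d)
    have hd' : Function.Exact ((LinearMap.ker g).subtype ∘ₗ d) g :=
      hd.comp_exact_iff_exact.2 g.exact_subtype_ker_map
    have he' : Function.Exact ((LinearMap.ker d).subtype ∘ₗ e) ((LinearMap.ker g).subtype ∘ₗ d) :=
      he.comp_exact_iff_exact.2 <|
        d.exact_subtype_ker_map.comp_injective _ (LinearMap.ker g).injective_subtype (map_zero _)
    rw [zero_add, subsingleton_ext_one_iff_of_exact he' hd' hg,
      subsingleton_ext_one_iff_of_exact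
        (e := ((LinearMap.ker d).subtype ∘ₗ e).baseChange B)
        (d := ((LinearMap.ker g).subtype ∘ₗ d).baseChange B) (g := g.baseChange B)
        (Module.Flat.lTensor_exact B he') (Module.Flat.lTensor_exact B hd')
        (LinearMap.lTensor_surjective B hg),
      forall_exists_comp_baseChange_iff,
      ← lcomp_exact_iff _ _ he'.linearMap_comp_eq_zero, lcomp_baseChange_exact_iff,
      lcomp_exact_iff _ _ he'.linearMap_comp_eq_zero]
  | succ n ih =>
    obtain ⟨F, _, _, _, _, g, hg⟩ := Module.exists_finite_presentation.{u} A M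
    have hs := g.exact_subtype_ker_map
    rw [subsingleton_ext_add_two_iff_of_exact (LinearMap.ker g).injective_subtype hs hg,
      subsingleton_ext_add_two_iff_of_exact
        (f := (LinearMap.ker g).subtype.baseChange B) (g := g.baseChange B)
        (Module.Flat.lTensor_preserves_injective_linearMap _ (LinearMap.ker g).injective_subtype)
        (lTensor_exact B hs hg)
        (LinearMap.lTensor_surjective B hg), ih]

end

/-- (AC) descends along faithfully flat algebras: if a left-noetherian, faithfully
flat algebra `B` over a commutative noetherian ring `A` satisfies (AC), then so
does `A`. -/
theorem stmt12 (A : Type u) (B : Type u) [CommRing A] [IsNoetherianRing A]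
    [Ring B] [Algebra A B] [IsNoetherianRing B] [Module.FaithfullyFlat A B]
    (hB : SatisfiesAC B) : SatisfiesAC A := by
  intro M hM
  have hiff (N : ModuleCat.{u} A) (i : ℕ) :
      Subsingleton (ExtGroup (ModuleCat.of B (B ⊗[A] M)) (ModuleCat.of B (B ⊗[A] N)) (i + 1)) ↔
        Subsingleton (ExtGroup M N (i + 1)) :=
    (subsingleton_derivedExt_iff _ _ i).trans <|
      (subsingleton_ext_baseChange_iff N i M).trans (subsingleton_derivedExt_iff M N i).symm
  obtain ⟨b, hb⟩ := hB (ModuleCat.of B (B ⊗[A] M)) (Module.Finite.base_change A B M)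
  refine ⟨b, fun N hN ⟨n, hn⟩ i hi ↦ ?_⟩
  obtain ⟨i, rfl⟩ := Nat.exists_eq_succ_of_ne_zero (Nat.ne_zero_of_lt hi)
  refine (hiff N i).1 (hb (ModuleCat.of B (B ⊗[A] N)) (Module.Finite.base_change A B N)
    ⟨n + 1, fun j hj ↦ ?_⟩ _ hi)
  obtain ⟨j, rfl⟩ := Nat.exists_eq_succ_of_ne_zero (Nat.ne_zero_of_lt hj)
  exact (hiff N j).2 (hn _ (by lia))
end
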